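/- arXiv:1709.01840 — 3 statements merged into one kernel-verified Lean document; each statement's English description precedes it below -/
import Mathlib

section
/- Let n ≥ 2 be an integer and let U ∈ Mₙ(ℂ) be unitary (Uᴴ·U = 1). Then U has both property (CN) and property (CR). -/
open Matrix

noncomputable def opN {n : ℕ} (M : Matrix (Fin n) (Fin n) ℂ) : ℝ :=
  ‖Matrix.toEuclideanCLM (𝕜 := ℂ) M‖

def HasCN {n : ℕ} (T : Matrix (Fin n) (Fin n) ℂ) : Prop :=
  ∀ P : Matrix (Fin n) (Fin n) ℂ, P * P = P → Pᴴ = P →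
    opN (P * T * (1 - P)) = opN ((1 - P) * T * P)

def HasCR {n : ℕ} (T : Matrix (Fin n) (Fin n) ℂ) : Prop :=
  ∀ P : Matrix (Fin n) (Fin n) ℂ, P * P = P → Pᴴ = P →
    (P * T * (1 - P)).rank = ((1 - P) * T * P).rank

open Unitary in
theorem exists_unitary_mul_conjTranspose_eq_conj {n : ℕ} (E : Matrix (Fin n) (Fin n) ℂ) :
    ∃ V : unitary (Matrix (Fin n) (Fin n) ℂ),
      E * Eᴴ = conjStarAlgAut ℂ _ V (Eᴴ * E) := by
  have hA := isHermitian_mul_conjTranspose_self E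
  have hB := isHermitian_conjTranspose_mul_self E
  have h := (hA.eigenvalues_eq_eigenvalues_iff hB).2 (charpoly_mul_comm E Eᴴ)
  refine ⟨hA.eigenvectorUnitary * star hB.eigenvectorUnitary, ?_⟩
  rw [conjStarAlgAut_mul_apply, hB.conjStarAlgAut_star_eigenvectorUnitary, ← h]
  exact hA.spectral_theorem

/-- The off-diagonal corner `P * U * (1 - P)` has as its Gram matrix the defect of the
dilated compression `P * U * P + (1 - P)`. -/
theorem corner_mul_conjTranspose {n : ℕ} {U P : Matrix (Fin n) (Fin n) ℂ}
    (hU : U * Uᴴ = 1) (hP : P * P = P) (hPH : Pᴴ = P) :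
    (P * U * (1 - P)) * (P * U * (1 - P))ᴴ =
      1 - (P * U * P + (1 - P)) * (P * U * P + (1 - P))ᴴ := by
  have hP' : ∀ Z, P * (P * Z) = P * Z := fun Z => by rw [← mul_assoc, hP]
  have hU' : ∀ Z, U * (Uᴴ * Z) = Z := fun Z => by rw [← mul_assoc, hU, one_mul]
  simp only [conjTranspose_mul, conjTranspose_add, conjTranspose_sub, conjTranspose_one, hPH,
    mul_sub, sub_mul, mul_add, add_mul, mul_assoc, hP, hP', hU', mul_one, one_mul]
  abel

theorem exists_unitary_corner_eq_conj {n : ℕ} {U P : Matrix (Fin n) (Fin n) ℂ}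
    (hU : Uᴴ * U = 1) (hP : P * P = P) (hPH : Pᴴ = P) :
    ∃ V : unitary (Matrix (Fin n) (Fin n) ℂ),
      (P * U * (1 - P)) * (P * U * (1 - P))ᴴ =
        (V : Matrix (Fin n) (Fin n) ℂ) * (((1 - P) * U * P)ᴴ * ((1 - P) * U * P)) *
          star (V : Matrix (Fin n) (Fin n) ℂ) := by
  obtain ⟨V, hV⟩ := exists_unitary_mul_conjTranspose_eq_conj (P * U * P + (1 - P))
  refine ⟨V, ?_⟩
  have hY := corner_mul_conjTranspose (U := Uᴴ) (by simpa using hU) hP hPH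
  have hYH : P * Uᴴ * (1 - P) = ((1 - P) * U * P)ᴴ := by
    simp [conjTranspose_mul, hPH, mul_assoc]
  have hEH : P * Uᴴ * P + (1 - P) = (P * U * P + (1 - P))ᴴ := by
    simp [conjTranspose_mul, hPH, mul_assoc]
  rw [hYH, hEH, conjTranspose_conjTranspose, conjTranspose_conjTranspose] at hY
  rw [corner_mul_conjTranspose (mul_eq_one_comm.1 hU) hP hPH, hV, hY,
    Unitary.conjStarAlgAut_apply, mul_sub, sub_mul, mul_one, Unitary.mul_star_self_of_mem V.2]

open scoped Matrix.Norms.L2Operator in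
theorem hasCN_of_conjTranspose_mul_self_eq_one {n : ℕ} {U : Matrix (Fin n) (Fin n) ℂ}
    (hU : Uᴴ * U = 1) : HasCN U := by
  intro P hP hPH
  obtain ⟨V, hV⟩ := exists_unitary_corner_eq_conj hU hP hPH
  have h := congrArg norm hV
  rw [← Unitary.coe_star, CStarRing.norm_mul_coe_unitary, CStarRing.norm_coe_unitary_mul,
    ← star_eq_conjTranspose (P * U * (1 - P)), CStarRing.norm_self_mul_star,
    l2_opNorm_conjTranspose_mul_self] at h
  exact (mul_self_inj (norm_nonneg _) (norm_nonneg _)).1 h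

open scoped ComplexOrder in
theorem hasCR_of_conjTranspose_mul_self_eq_one {n : ℕ} {U : Matrix (Fin n) (Fin n) ℂ}
    (hU : Uᴴ * U = 1) : HasCR U := by
  intro P hP hPH
  obtain ⟨V, hV⟩ := exists_unitary_corner_eq_conj hU hP hPH
  have hdet : IsUnit (V : Matrix (Fin n) (Fin n) ℂ).det :=
    (isUnit_iff_isUnit_det _).1 (Unitary.toUnits V).isUnit
  have hdet' : IsUnit (star (V : Matrix (Fin n) (Fin n) ℂ)).det :=
    (isUnit_iff_isUnit_det _).1 (Unitary.toUnits (star V)).isUnit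
  rw [← rank_self_mul_conjTranspose, hV, rank_mul_eq_left_of_isUnit_det _ _ hdet',
    rank_mul_eq_right_of_isUnit_det _ _ hdet, rank_conjTranspose_mul_self]

theorem stmt1 {n : ℕ} (hn : 2 ≤ n) (U : Matrix (Fin n) (Fin n) ℂ)
    (hU : Uᴴ * U = 1) : HasCN U ∧ HasCR U :=
  ⟨hasCN_of_conjTranspose_mul_self_eq_one hU, hasCR_of_conjTranspose_mul_self_eq_one hU⟩
end

section
/- Let 2 ≤ n ≤ 3 and let T ∈ Mₙ(ℂ). The following are equivalent: (a) T is normal; (b) T has property (CN); (c) T has property (CR). -/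
open Matrix

theorem opN_eq_zero {n : ℕ} {M : Matrix (Fin n) (Fin n) ℂ} : opN M = 0 ↔ M = 0 := by
  rw [opN, norm_eq_zero, EmbeddingLike.map_eq_zero_iff]

theorem rank_eq_zero_iff_eq_zero {n : ℕ} {M : Matrix (Fin n) (Fin n) ℂ} :
    M.rank = 0 ↔ M = 0 := by
  refine ⟨fun h => ?_, fun h => by rw [h, Matrix.rank_zero]⟩
  rw [Matrix.rank, Submodule.finrank_eq_zero, LinearMap.range_eq_bot] at h
  ext i j
  have := congrFun (LinearMap.congr_fun h (Pi.single j 1)) i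
  simpa using this

theorem exists_eq_vecMulVec_of_rank_le_one {n : ℕ} {M : Matrix (Fin n) (Fin n) ℂ}
    (h : M.rank ≤ 1) : ∃ u v : Fin n → ℂ, M = vecMulVec u v := by
  rw [Matrix.rank, finrank_le_one_iff] at h
  obtain ⟨u, hu⟩ := h
  choose c hc using fun j => hu ⟨M.mulVecLin (Pi.single j 1), LinearMap.mem_range_self _ _⟩
  refine ⟨u, c, ?_⟩
  ext i j
  have := congrFun (congrArg Subtype.val (hc j)) i
  simp at this
  rw [← this, vecMulVec_apply, mul_comm]

theorem opN_vecMulVec {n : ℕ} (u v : Fin n → ℂ) :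
    opN (vecMulVec u v) = ‖WithLp.toLp 2 u‖ * ‖WithLp.toLp 2 (star v)‖ := by
  rw [← InnerProductSpace.norm_rankOne (𝕜 := ℂ), opN]
  congr 1
  ext x i
  simp [Matrix.vecMulVec_mulVec, EuclideanSpace.inner_eq_star_dotProduct, dotProduct_comm, mul_comm]

/-- For matrices of rank at most one the operator norm is the Frobenius norm. -/
theorem opN_sq_of_rank_le_one {n : ℕ} {M : Matrix (Fin n) (Fin n) ℂ} (h : M.rank ≤ 1) :
    ((opN M ^ 2 : ℝ) : ℂ) = (M * Mᴴ).trace := by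
  obtain ⟨u, v, rfl⟩ := exists_eq_vecMulVec_of_rank_le_one h
  rw [opN_vecMulVec, mul_pow, EuclideanSpace.norm_sq_eq, EuclideanSpace.norm_sq_eq,
    conjTranspose_vecMulVec, vecMulVec_mul_vecMulVec, trace_vecMulVec, dotProduct_smul]
  simp [dotProduct, RCLike.mul_conj, mul_comm]

theorem trace_corner_eq {n : ℕ} {T P : Matrix (Fin n) (Fin n) ℂ} (hT : T * Tᴴ = Tᴴ * T)
    (h1 : P * P = P) (h2 : Pᴴ = P) :
    (P * T * (1 - P) * (P * T * (1 - P))ᴴ).trace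
      = ((1 - P) * T * P * ((1 - P) * T * P)ᴴ).trace := by
  have hQ : (1 - P) * (1 - P) = 1 - P := by simp [mul_sub, sub_mul, h1]
  have e1 : (P * T * (1 - P) * (P * T * (1 - P))ᴴ).trace
      = (P * (T * Tᴴ)).trace - (P * T * P * Tᴴ).trace := by
    have : P * T * (1 - P) * (P * T * (1 - P))ᴴ = P * T * ((1 - P) * (1 - P)) * Tᴴ * P := by
      simp only [conjTranspose_mul, conjTranspose_sub, conjTranspose_one, h2, mul_assoc]
    rw [this, hQ, trace_mul_comm, ← trace_sub]
    congr 1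
    simp only [mul_sub, sub_mul, mul_one, ← mul_assoc, h1]
  have t1 : (T * P * Tᴴ).trace = (P * (Tᴴ * T)).trace := by
    rw [mul_assoc, trace_mul_comm, mul_assoc]
  have t2 : (T * P * Tᴴ * P).trace = (P * T * P * Tᴴ).trace := by
    rw [trace_mul_comm, ← mul_assoc, ← mul_assoc]
  have e2 : ((1 - P) * T * P * ((1 - P) * T * P)ᴴ).trace
      = (P * (Tᴴ * T)).trace - (P * T * P * Tᴴ).trace := by
    have : (1 - P) * T * P * ((1 - P) * T * P)ᴴ = (1 - P) * (T * (P * P) * Tᴴ * (1 - P)) := by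
      simp only [conjTranspose_mul, conjTranspose_sub, conjTranspose_one, h2, mul_assoc]
    rw [this, h1, trace_mul_comm, mul_assoc _ (1 - P), hQ, mul_sub, mul_one, trace_sub, t1, t2]
  rw [e1, e2, hT]

theorem rank_corner_le_one {n : ℕ} (hn : n ≤ 3) {P : Matrix (Fin n) (Fin n) ℂ} (h : P * P = P)
    (T : Matrix (Fin n) (Fin n) ℂ) :
    (P * T * (1 - P)).rank ≤ 1 ∧ ((1 - P) * T * P).rank ≤ 1 := by
  have h0 : P * (1 - P) = 0 := by rw [mul_sub, mul_one, h, sub_self]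
  have hr := rank_add_rank_le_card_of_mul_eq_zero h0
  rw [Fintype.card_fin] at hr
  have a1 := rank_mul_le_right (P * T) (1 - P)
  have a2 := (rank_mul_le_left (P * T) (1 - P)).trans (rank_mul_le_left P T)
  have b1 := rank_mul_le_right ((1 - P) * T) P
  have b2 := (rank_mul_le_left ((1 - P) * T) P).trans (rank_mul_le_left (1 - P) T)
  omega

theorem hasCN_of_normal {n : ℕ} (hn : n ≤ 3) {T : Matrix (Fin n) (Fin n) ℂ}
    (hT : T * Tᴴ = Tᴴ * T) : HasCN T := by
  intro P h1 h2
  obtain ⟨ha, hb⟩ := rank_corner_le_one hn h1 T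
  have h := trace_corner_eq hT h1 h2
  rw [← opN_sq_of_rank_le_one ha, ← opN_sq_of_rank_le_one hb, Complex.ofReal_inj] at h
  exact (sq_eq_sq₀ (norm_nonneg _) (norm_nonneg _)).1 h

theorem hasCR_of_normal {n : ℕ} (hn : n ≤ 3) {T : Matrix (Fin n) (Fin n) ℂ}
    (hT : T * Tᴴ = Tᴴ * T) : HasCR T := by
  intro P h1 h2
  obtain ⟨ha, hb⟩ := rank_corner_le_one hn h1 T
  have h := hasCN_of_normal hn hT P h1 h2
  have h0 : (P * T * (1 - P)).rank = 0 ↔ ((1 - P) * T * P).rank = 0 := by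
    rw [rank_eq_zero_iff_eq_zero, rank_eq_zero_iff_eq_zero, ← opN_eq_zero, ← opN_eq_zero, h]
  omega

theorem conjTranspose_mulVec_eq_of_unit_eigenvector {n : ℕ} {T : Matrix (Fin n) (Fin n) ℂ}
    (hT : ∀ P : Matrix (Fin n) (Fin n) ℂ, P * P = P → Pᴴ = P →
      (1 - P) * T * P = 0 → P * T * (1 - P) = 0)
    {e : Fin n → ℂ} (he : star e ⬝ᵥ e = 1) {μ : ℂ} (h : T *ᵥ e = μ • e) :
    Tᴴ *ᵥ e = star μ • e := by
  set P := vecMulVec e (star e) with hP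
  have h1 : P * P = P := by rw [hP, vecMulVec_mul_vecMulVec, he, one_smul]
  have h2 : Pᴴ = P := by rw [hP, conjTranspose_vecMulVec, star_star]
  have hTP : T * P = μ • P := by rw [hP, mul_vecMulVec, h, smul_vecMulVec]
  have h3 : P * T * (1 - P) = 0 := by
    apply hT P h1 h2
    rw [mul_assoc, hTP, Matrix.mul_smul, sub_mul, one_mul, h1, sub_self, smul_zero]
  have hPT : P * T = μ • P := by
    rw [mul_sub, mul_one, sub_eq_zero, mul_assoc, hTP, Matrix.mul_smul, h1] at h3
    exact h3
  have hPT' : Tᴴ * P = star μ • P := by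
    have := congrArg conjTranspose hPT
    rwa [conjTranspose_mul, conjTranspose_smul, h2] at this
  have hPe : P *ᵥ e = e := by rw [hP, vecMulVec_mulVec, he, MulOpposite.op_one, one_smul]
  calc Tᴴ *ᵥ e = (Tᴴ * P) *ᵥ e := by rw [← mulVec_mulVec, hPe]
    _ = star μ • e := by rw [hPT', smul_mulVec, hPe]

theorem conjTranspose_mulVec_eq_of_eigenvector {n : ℕ} {T : Matrix (Fin n) (Fin n) ℂ}
    (hT : ∀ P : Matrix (Fin n) (Fin n) ℂ, P * P = P → Pᴴ = P →
      (1 - P) * T * P = 0 → P * T * (1 - P) = 0)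
    {v : Fin n → ℂ} {μ : ℂ} (h : T *ᵥ v = μ • v) : Tᴴ *ᵥ v = star μ • v := by
  by_cases hv : v = 0
  · simp [hv]
  have hv' : WithLp.toLp 2 v ≠ 0 := by simpa using hv
  set r : ℂ := (‖WithLp.toLp 2 v‖ : ℂ) with hr
  have hr0 : r ≠ 0 := by simpa [hr] using hv
  have hvv : star v ⬝ᵥ v = r ^ 2 := by
    have := inner_self_eq_norm_sq_to_K (𝕜 := ℂ) (WithLp.toLp 2 v)
    rw [EuclideanSpace.inner_eq_star_dotProduct, dotProduct_comm] at this
    exact this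
  have hsr : star r = r := Complex.conj_ofReal _
  have key := conjTranspose_mulVec_eq_of_unit_eigenvector hT (e := r⁻¹ • v) (μ := μ)
    (by rw [star_smul, smul_dotProduct, dotProduct_smul, hvv, star_inv₀, hsr, smul_eq_mul,
          smul_eq_mul]; field_simp)
    (by rw [mulVec_smul, h, smul_comm])
  rw [mulVec_smul, smul_comm] at key
  exact smul_right_injective _ (inv_ne_zero hr0) key

open Module.End in
/-- A matrix all of whose one-dimensional invariant subspaces reduce it is normal. -/
theorem normal_of_invariant_imp_reducing {n : ℕ} {T : Matrix (Fin n) (Fin n) ℂ}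
    (hT : ∀ P : Matrix (Fin n) (Fin n) ℂ, P * P = P → Pᴴ = P →
      (1 - P) * T * P = 0 → P * T * (1 - P) = 0) : T * Tᴴ = Tᴴ * T := by
  set L := toEuclideanLin T with hL
  have hadj : LinearMap.adjoint L = toEuclideanLin Tᴴ :=
    (toEuclideanLin_conjTranspose_eq_adjoint T).symm
  have heig : ∀ (μ : ℂ) (x : EuclideanSpace ℂ (Fin n)), L x = μ • x →
      LinearMap.adjoint L x = star μ • x := by
    intro μ x hx
    have h := conjTranspose_mulVec_eq_of_eigenvector hT (v := x.ofLp) (μ := μ)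
      (congrArg WithLp.ofLp hx)
    rw [hadj]
    exact congrArg (WithLp.toLp 2) h
  set W : Submodule ℂ (EuclideanSpace ℂ (Fin n)) := ⨆ μ : ℂ, eigenspace L μ with hW
  have hinv : ∀ x ∈ Wᗮ, L x ∈ Wᗮ := by
    intro x hx
    rw [hW, ← Submodule.iInf_orthogonal, Submodule.mem_iInf] at hx ⊢
    intro μ
    rw [Submodule.mem_orthogonal]
    intro u hu
    rw [← LinearMap.adjoint_inner_left, heig μ u (mem_eigenspace_iff.1 hu), inner_smul_left,
      (Submodule.mem_orthogonal _ _).1 (hx μ) u hu, mul_zero]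
  have htop : W = ⊤ := by
    by_contra hne
    have hbot : Wᗮ ≠ ⊥ := fun h => hne ((Submodule.orthogonal_eq_bot_iff).1 h)
    have : Nontrivial Wᗮ := Submodule.nontrivial_iff_ne_bot.2 hbot
    obtain ⟨μ, hμ⟩ := exists_eigenvalue (L.restrict hinv)
    obtain ⟨x, hx⟩ := hμ.exists_hasEigenvector
    have hxW : (x : EuclideanSpace ℂ (Fin n)) ∈ W := by
      refine Submodule.mem_iSup_of_mem μ (mem_eigenspace_iff.2 ?_)
      exact congrArg Subtype.val hx.apply_eq_smul
    apply hx.2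
    have := (Submodule.mem_orthogonal _ _).1 x.2 x hxW
    exact Subtype.ext (inner_self_eq_zero.1 this)
  have hle : W ≤ LinearMap.eqLocus (L ∘ₗ LinearMap.adjoint L) (LinearMap.adjoint L ∘ₗ L) := by
    refine iSup_le fun μ x hx => ?_
    have hx' := mem_eigenspace_iff.1 hx
    rw [LinearMap.mem_eqLocus, LinearMap.comp_apply, LinearMap.comp_apply, hx', heig μ x hx',
      map_smul, map_smul, hx', heig μ x hx', smul_comm]
  apply (toEuclideanLin (𝕜 := ℂ)).injective
  ext1 x
  have hx : x ∈ W := htop ▸ Submodule.mem_top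
  have h := hle hx
  rw [LinearMap.mem_eqLocus, hadj] at h
  simpa [hL, toLpLin_apply] using h

theorem stmt3 {n : ℕ} (hn2 : 2 ≤ n) (hn3 : n ≤ 3) (T : Matrix (Fin n) (Fin n) ℂ) :
    (HasCN T ↔ T * Tᴴ = Tᴴ * T) ∧ (HasCR T ↔ T * Tᴴ = Tᴴ * T) := by
  refine ⟨⟨fun h => normal_of_invariant_imp_reducing fun P h1 h2 h3 => ?_, hasCN_of_normal hn3⟩,
    ⟨fun h => normal_of_invariant_imp_reducing fun P h1 h2 h3 => ?_, hasCR_of_normal hn3⟩⟩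
  · rw [← opN_eq_zero, h P h1 h2, h3, opN_eq_zero]
  · rw [← rank_eq_zero_iff_eq_zero, h P h1 h2, h3, rank_eq_zero_iff_eq_zero]
end

section
/- Let T ∈ M₄(ℂ) be normal with spectrum (set of eigenvalues) equal to {0, 1, 2, δ}, where δ ∈ ℂ is not real. Then there exists a unitary matrix U ∈ M₄(ℂ) such that the NE corner of Uᴴ·T·U has rank strictly less than 2, while the SW corner of Uᴴ·T·U has rank equal to 2. -/
open Matrix

/-- The NE (north-east) 2×2 corner of a 4×4 matrix. -/
def NE (T : Matrix (Fin 4) (Fin 4) ℂ) : Matrix (Fin 2) (Fin 2) ℂ :=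
  ![![T 0 2, T 0 3], ![T 1 2, T 1 3]]

/-- The SW (south-west) 2×2 corner of a 4×4 matrix. -/
def SW (T : Matrix (Fin 4) (Fin 4) ℂ) : Matrix (Fin 2) (Fin 2) ℂ :=
  ![![T 2 0, T 2 1], ![T 3 0, T 3 1]]

/-- QR factorization: the columns of a square matrix are upper triangular in some
orthonormal basis. -/
lemma exists_unitary_conjTranspose_mul_isUpperTriangular {n : ℕ}
    (F : Matrix (Fin n) (Fin n) ℂ) :
    ∃ Q : Matrix (Fin n) (Fin n) ℂ, Qᴴ * Q = 1 ∧ ∀ i j, j < i → (Qᴴ * F) i j = 0 := by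
  let f : Fin n → EuclideanSpace ℂ (Fin n) := fun j => WithLp.toLp 2 fun i => F i j
  let b := InnerProductSpace.gramSchmidtOrthonormalBasis (𝕜 := ℂ) (by simp) f
  refine ⟨Matrix.of fun i j => b j i, ?_, fun i j hij => ?_⟩
  · ext i j
    have h := orthonormal_iff_ite.mp b.orthonormal i j
    simpa [PiLp.inner_apply, Matrix.mul_apply, Matrix.one_apply, mul_comm] using h
  · have h := InnerProductSpace.gramSchmidtOrthonormalBasis_inv_triangular
      (𝕜 := ℂ) (by simp) f hij
    simpa [PiLp.inner_apply, Matrix.mul_apply, mul_comm, f, b] using h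

open scoped ComplexOrder in
/-- An eigenvector of a normal matrix is an eigenvector of its conjugate transpose, for the
conjugate eigenvalue. -/
lemma conjTranspose_mulVec_eq_of_normal {n : Type*} [Fintype n] [DecidableEq n]
    {T : Matrix n n ℂ} (hT : T * Tᴴ = Tᴴ * T) {μ : ℂ} {v : n → ℂ} (hv : T *ᵥ v = μ • v) :
    Tᴴ *ᵥ v = star μ • v := by
  set S : Matrix n n ℂ := T - μ • 1 with hS
  have hSn : S * Sᴴ = Sᴴ * S := by
    simp [hS, sub_mul, mul_sub, hT, smul_sub, smul_comm μ (starRingEnd ℂ μ)]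
    abel
  have hSv : S *ᵥ v = 0 := by simp [hS, sub_mulVec, smul_mulVec, hv]
  have h : Sᴴ *ᵥ v = 0 := by
    rw [← dotProduct_star_self_eq_zero, star_mulVec, conjTranspose_conjTranspose,
      ← dotProduct_mulVec, mulVec_mulVec, hSn, ← mulVec_mulVec, hSv]
    simp
  simpa [hS, sub_mulVec, smul_mulVec, sub_eq_zero] using h

lemma mul_apply_eq_of_col_eq {l m n : Type*} [Fintype m] (Z : Matrix l m ℂ)
    {X Y : Matrix m n ℂ} {a b : n} (h : ∀ i, X i a = Y i b) (i : l) :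
    (Z * X) i a = (Z * Y) i b := by
  simp [Matrix.mul_apply, h]

/-- The values of the functions `1, z, star z, star z * z` at the points `d i`. -/
def monomialValues (d : Fin 4 → ℂ) : Matrix (Fin 4) (Fin 4) ℂ :=
  Matrix.of fun i => ![1, d i, star (d i), star (d i) * d i]

lemma monomialValues_det_ne_zero {δ : ℂ} (hδ : δ.im ≠ 0) :
    (monomialValues ![0, 1, 2, δ]).det ≠ 0 := by
  have h : (monomialValues ![0, 1, 2, δ]).det = 2 * (δ - star δ) := by
    have h2 : (starRingEnd ℂ) 2 = 2 := Complex.conj_ofNat 2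
    simp [monomialValues, Matrix.det_succ_row_zero, Fin.sum_univ_succ, Fin.succAbove, h2]
    ring
  rw [h]
  exact mul_ne_zero two_ne_zero
    (sub_ne_zero.mpr fun h' => hδ (Complex.conj_eq_iff_im.mp h'.symm))

lemma corner_dets {A R : Matrix (Fin 4) (Fin 4) ℂ} (hR : ∀ i j, j < i → R i j = 0)
    (hdet : R.det ≠ 0) (h₀ : ∀ i, (A * R) i 0 = R i 1) (h₁ : ∀ i, (Aᴴ * R) i 0 = R i 2)
    (h₂ : ∀ i, (Aᴴ * R) i 1 = R i 3) :
    A 2 0 * A 3 1 - A 2 1 * A 3 0 = 0 ∧ A 0 2 * A 1 3 - A 0 3 * A 1 2 ≠ 0 := by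
  have hprod : R.det = ∏ i, R i i := Matrix.det_of_isUpperTriangular fun i j h => hR i j h
  rw [hprod, Fin.prod_univ_four] at hdet
  have r10 := hR 1 0 (by decide)
  have r20 := hR 2 0 (by decide)
  have r30 := hR 3 0 (by decide)
  have r21 := hR 2 1 (by decide)
  have r31 := hR 3 1 (by decide)
  have r32 := hR 3 2 (by decide)
  simp only [Matrix.mul_apply, Fin.sum_univ_four, conjTranspose_apply, r10, r20, r30, r21, r31,
    mul_zero, add_zero] at h₀ h₁ h₂
  simp only [mul_ne_zero_iff] at hdet
  obtain ⟨⟨⟨n0, n1⟩, n2⟩, n3⟩ := hdet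
  have a20 : A 2 0 = 0 := by simpa [r21, n0] using h₀ 2
  have a30 : A 3 0 = 0 := by simpa [r31, n0] using h₀ 3
  have a03 : A 0 3 = 0 := by simpa [r32, n0] using h₁ 3
  have a02 : A 0 2 ≠ 0 := fun h => n2 (by simpa [h] using (h₁ 2).symm)
  have a13 : A 1 3 ≠ 0 := fun h => n3 (by simpa [h, a03] using (h₂ 3).symm)
  exact ⟨by simp [a20, a30], by simp [a03, a02, a13]⟩

theorem stmt7 (T : Matrix (Fin 4) (Fin 4) ℂ)
    (hnormal : T * Tᴴ = Tᴴ * T) (δ : ℂ) (hδ : δ.im ≠ 0)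
    (hspec : spectrum ℂ T = {0, 1, 2, δ}) :
    ∃ U : Matrix (Fin 4) (Fin 4) ℂ, Uᴴ * U = 1 ∧
      (NE (Uᴴ * T * U)).rank < 2 ∧ (SW (Uᴴ * T * U)).rank = 2 := by
  let d : Fin 4 → ℂ := ![0, 1, 2, δ]
  have hδ0 : δ ≠ 0 := by rintro rfl; simp at hδ
  have hδ1 : δ ≠ 1 := by rintro rfl; simp at hδ
  have hδ2 : δ ≠ 2 := by rintro rfl; simp at hδ
  have hd : Function.Injective d := by
    intro i j hij
    fin_cases i <;> fin_cases j <;> simp_all [d, eq_comm]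
  have hev : ∀ i, ∃ v, Module.End.HasEigenvector (Matrix.toLin' T) (d i) v := fun i => by
    refine Module.End.HasEigenvalue.exists_hasEigenvector ?_
    rw [Module.End.hasEigenvalue_iff_mem_spectrum, Matrix.spectrum_toLin', hspec]
    fin_cases i <;> simp [d]
  choose v hv using hev
  have hTv : ∀ i, T *ᵥ v i = d i • v i := fun i => by simpa using (hv i).apply_eq_smul
  have hTv' : ∀ i, Tᴴ *ᵥ v i = star (d i) • v i := fun i =>
    conjTranspose_mulVec_eq_of_normal hnormal (hTv i)
  let P : Matrix (Fin 4) (Fin 4) ℂ := Matrix.of fun i j => v j i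
  have hP : P.det ≠ 0 := by
    have : IsUnit P := Matrix.linearIndependent_cols_iff_isUnit.mp
      (Module.End.eigenvectors_linearIndependent' _ d hd v hv)
    exact ((Matrix.isUnit_iff_isUnit_det _).mp this).ne_zero
  have hTP : T * P = P * diagonal d := by
    ext i j
    rw [Matrix.mul_diagonal]
    simpa [P, mulVec, dotProduct, Matrix.mul_apply, mul_comm] using congrFun (hTv j) i
  have hTP' : Tᴴ * P = P * diagonal (star d) := by
    ext i j
    rw [Matrix.mul_diagonal]
    simpa [P, mulVec, dotProduct, Matrix.mul_apply, mul_comm] using congrFun (hTv' j) i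
  let M := monomialValues d
  obtain ⟨Q, hQ, hR⟩ := exists_unitary_conjTranspose_mul_isUpperTriangular (P * M)
  have hQ' : Q * Qᴴ = 1 := mul_eq_one_comm.mp hQ
  have hdet : (Qᴴ * (P * M)).det ≠ 0 := by
    rw [det_mul, det_mul]
    refine mul_ne_zero (fun h => ?_) (mul_ne_zero hP (monomialValues_det_ne_zero hδ))
    simpa [h] using congrArg Matrix.det hQ
  have hA : (Qᴴ * T * Q) * (Qᴴ * (P * M)) = Qᴴ * (P * (diagonal d * M)) := by
    calc _ = Qᴴ * T * (Q * Qᴴ) * (P * M) := by simp only [Matrix.mul_assoc]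
      _ = Qᴴ * ((T * P) * M) := by simp only [hQ', Matrix.mul_assoc, Matrix.one_mul]
      _ = _ := by simp only [hTP, Matrix.mul_assoc]
  have hA' : (Qᴴ * T * Q)ᴴ * (Qᴴ * (P * M)) = Qᴴ * (P * (diagonal (star d) * M)) := by
    calc _ = Qᴴ * Tᴴ * (Q * Qᴴ) * (P * M) := by
          simp only [conjTranspose_mul, conjTranspose_conjTranspose, Matrix.mul_assoc]
      _ = Qᴴ * ((Tᴴ * P) * M) := by simp only [hQ', Matrix.mul_assoc, Matrix.one_mul]
      _ = _ := by simp only [hTP', Matrix.mul_assoc]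
  obtain ⟨hne, hsw⟩ := corner_dets hR hdet
    (fun i => by
      rw [hA]
      exact mul_apply_eq_of_col_eq _ (mul_apply_eq_of_col_eq _ fun k => by
        simp [M, monomialValues]) i)
    (fun i => by
      rw [hA']
      exact mul_apply_eq_of_col_eq _ (mul_apply_eq_of_col_eq _ fun k => by
        simp [M, monomialValues]) i)
    (fun i => by
      rw [hA']
      exact mul_apply_eq_of_col_eq _ (mul_apply_eq_of_col_eq _ fun k => by
        simp [M, monomialValues]) i)
  let σ : Fin 4 ≃ Fin 4 := Equiv.addRight 2
  refine ⟨Q.submatrix id σ, ?_, ?_, ?_⟩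
  · calc _ = (Qᴴ * Q).submatrix σ σ := rfl
      _ = 1 := by rw [hQ, submatrix_one_equiv]
  · change (NE ((Qᴴ * T * Q).submatrix σ σ)).rank < 2
    have hdetNE : (NE ((Qᴴ * T * Q).submatrix σ σ)).det = 0 := by
      rw [det_fin_two]
      exact hne
    refine lt_of_le_of_ne (Matrix.rank_le_width _) fun hrank => ?_
    have hunit : IsUnit (NE ((Qᴴ * T * Q).submatrix σ σ)) := by
      rw [← Matrix.linearIndependent_cols_iff_isUnit, linearIndependent_iff_card_eq_finrank_span,
        Set.finrank, ← Matrix.rank_eq_finrank_span_cols, hrank, Fintype.card_fin]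
    exact ((Matrix.isUnit_iff_isUnit_det _).mp hunit).ne_zero hdetNE
  · change (SW ((Qᴴ * T * Q).submatrix σ σ)).rank = 2
    have hdetSW : (SW ((Qᴴ * T * Q).submatrix σ σ)).det ≠ 0 := by
      rw [det_fin_two]
      exact hsw
    simpa using Matrix.rank_of_isUnit _ ((Matrix.isUnit_iff_isUnit_det _).mpr hdetSW.isUnit)
end
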